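/- Lemma 3.2. Let (a_n)_{n≥1} be a positive decreasing sequence and let ρ : [1,∞) → (0,∞) be an increasing function. Suppose there exist β > 1 and γ > 1 such that t ↦ ρ(t)/t^γ is increasing and t ↦ ρ(t)/t^β is decreasing. Let p ∈ (0, 1/β) and suppose there exists B > 0 such that for every increasing concave function h : [0,∞) → [0,∞) with t ↦ h(t)/t^p increasing, one has (1/B) ∑_{n≥1} h(1/ρ(n)) ≤ ∑_{n≥1} h(a_n) ≤ B ∑_{n≥1} h(1/ρ(n)). Then a_n ≍ 1/ρ(n), i.e., there exist constants c, C > 0 with c/ρ(n) ≤ a_n ≤ C/ρ(n) for all n ≥ 1. -/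

import Mathlib

open Filter Set
open scoped ENNReal Topology

/-- The test function `min t (s ^ (1 - p) * t ^ p)`, which crosses over at `t = s`. -/
noncomputable def crossover (p s t : ℝ) : ℝ := min t (s ^ (1 - p) * t ^ p)

namespace crossover

variable {p s t : ℝ}

lemma nonneg (hs : 0 < s) (ht : 0 ≤ t) : 0 ≤ crossover p s t :=
  le_min ht (by positivity)

lemma monotoneOn (hp : 0 < p) (hs : 0 < s) : MonotoneOn (crossover p s) (Ici 0) := by
  intro x hx y _ hxy
  have hx : 0 ≤ x := hx
  unfold crossover
  gcongr

lemma concaveOn (hp : 0 < p) (hp1 : p < 1) (hs : 0 < s) :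
    ConcaveOn ℝ (Ici 0) (crossover p s) :=
  (concaveOn_id (convex_Ici 0)).inf
    ((Real.concaveOn_rpow hp.le hp1.le).smul (by positivity : 0 ≤ s ^ (1 - p)))

lemma monotoneOn_div_rpow (hp1 : p < 1) :
    MonotoneOn (fun t => crossover p s t / t ^ p) (Ioi 0) := by
  have key : ∀ t ∈ Ioi (0 : ℝ), crossover p s t / t ^ p = min (t ^ (1 - p)) (s ^ (1 - p)) := by
    intro t ht
    have ht : 0 < t := ht
    have htp : 0 < t ^ p := by positivity
    rw [crossover, ← min_div_div_right htp.le, mul_div_cancel_right₀ _ htp.ne',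
      Real.rpow_sub ht, Real.rpow_one]
  intro x hx y hy hxy
  have hx0 : 0 < x := hx
  have : 0 < 1 - p := by linarith
  simp only [key x hx, key y hy]
  gcongr

lemma self (hs : 0 < s) : crossover p s s = s := by
  rw [crossover, ← Real.rpow_add hs]
  simp

lemma le_of_le (hp : 0 < p) (hs : 0 < s) (hst : s ≤ t) : s ≤ crossover p s t := by
  simpa only [self hs] using monotoneOn hp hs hs.le (hs.le.trans hst) hst

end crossover

/-- If all partial sums of `g` are at most `S` and `∑ f ≤ B ∑ g` in `[0, ∞]`, then all partial
sums of `f` are at most `B * S`. -/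
lemma sum_range_le_mul_of_tsum_ofReal_le {f g : ℕ → ℝ} {B S : ℝ} (hf : ∀ k, 0 ≤ f k)
    (hg : ∀ k, 0 ≤ g k) (hB : 0 < B) (hS : ∀ N, ∑ k ∈ Finset.range N, g k ≤ S)
    (h : ∑' k, ENNReal.ofReal (f k) ≤ ENNReal.ofReal B * ∑' k, ENNReal.ofReal (g k)) (n : ℕ) :
    ∑ k ∈ Finset.range n, f k ≤ B * S := by
  have hS0 : 0 ≤ S := by simpa using hS 0
  rw [← ENNReal.ofReal_le_ofReal_iff (by positivity), ENNReal.ofReal_mul hB.le,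
    ENNReal.ofReal_sum_of_nonneg fun k _ => hf k]
  refine (ENNReal.sum_le_tsum _).trans (h.trans ?_)
  gcongr
  refine ENNReal.tsum_le_of_sum_range_le fun N => ?_
  rw [← ENNReal.ofReal_sum_of_nonneg fun k _ => hg k]
  exact ENNReal.ofReal_le_ofReal (hS N)

lemma sum_range_le_add_sum_Ico {g : ℕ → ℝ} (hg : ∀ k, 0 ≤ g k) (M N : ℕ) :
    ∑ k ∈ Finset.range N, g k ≤ ∑ k ∈ Finset.range M, g k + ∑ k ∈ Finset.Ico M N, g k := by
  rcases le_total M N with h | h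
  · rw [Finset.sum_range_add_sum_Ico _ h]
  · rw [Finset.Ico_eq_empty_of_le h, Finset.sum_empty, add_zero]
    exact Finset.sum_le_sum_of_subset_of_nonneg (Finset.range_mono h) fun k _ _ => hg k

lemma sum_range_rpow_neg_le {q : ℝ} (hq0 : 0 < q) (hq : q < 1) (n : ℕ) :
    ∑ k ∈ Finset.range n, ((k : ℝ) + 1) ^ (-q) ≤ (1 / (1 - q)) * (n : ℝ) ^ (1 - q) := by
  have hq' : 0 < 1 - q := by linarith
  induction n with
  | zero => simp [Real.zero_rpow hq'.ne']
  | succ n ih =>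
    rw [Finset.sum_range_succ]
    push_cast
    have hn : (0 : ℝ) < (n : ℝ) + 1 := by positivity
    have bern := rpow_one_add_le_one_add_mul_self (s := -1 / ((n : ℝ) + 1))
      (by rw [le_div_iff₀ hn]; linarith [(Nat.cast_nonneg n : (0 : ℝ) ≤ n)]) hq'.le (by linarith)
    have e1 : 1 + -1 / ((n : ℝ) + 1) = n / (n + 1) := by field_simp; ring
    rw [e1, Real.div_rpow (by positivity) hn.le, div_le_iff₀ (by positivity)] at bern
    have e2 : ((n : ℝ) + 1) ^ (1 - q) = (n + 1) * ((n : ℝ) + 1) ^ (-q) := by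
      rw [sub_eq_add_neg, Real.rpow_add hn, Real.rpow_one]
    rw [e2] at bern ⊢
    have e3 : (1 + (1 - q) * (-1 / ((n : ℝ) + 1))) * ((n + 1) * ((n : ℝ) + 1) ^ (-q))
        = (n + 1) * ((n : ℝ) + 1) ^ (-q) - (1 - q) * ((n : ℝ) + 1) ^ (-q) := by
      field_simp
      ring
    rw [e3] at bern
    rw [div_mul_eq_mul_div, one_mul, le_div_iff₀ hq'] at ih ⊢
    linarith

lemma sum_Ico_rpow_neg_le {r : ℝ} (hr : 1 < r) (m N : ℕ) :
    ∑ k ∈ Finset.Ico (m + 1) N, ((k : ℝ) + 1) ^ (-r)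
      ≤ (1 / (r - 1)) * ((m : ℝ) + 1) ^ (1 - r) := by
  have hr' : 0 < r - 1 := by linarith
  have key : ∀ k ∈ Finset.Ico (m + 1) N, ((k : ℝ) + 1) ^ (-r)
      ≤ (1 / (r - 1)) * ((k : ℝ) ^ (1 - r) - ((k + 1 : ℕ) : ℝ) ^ (1 - r)) := by
    intro k hk
    have hk : (0 : ℝ) < k := by
      have := (Finset.mem_Ico.1 hk).1
      exact_mod_cast (by omega : 0 < k)
    have hk1 : (0 : ℝ) < (k : ℝ) + 1 := by positivity
    have bern := one_add_mul_self_le_rpow_one_add (s := 1 / (k : ℝ))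
      (by linarith [(by positivity : 0 < 1 / (k : ℝ))]) hr.le
    have e1 : 1 + 1 / (k : ℝ) = (k + 1) / k := by field_simp
    rw [e1, Real.div_rpow hk1.le hk.le, le_div_iff₀ (by positivity)] at bern
    push_cast
    rw [div_mul_eq_mul_div, one_mul, le_div_iff₀ hr', Real.rpow_sub hk, Real.rpow_sub hk1,
      Real.rpow_neg hk1.le, Real.rpow_one, Real.rpow_one]
    have hA : 0 < (k : ℝ) ^ r := by positivity
    have hC : 0 < ((k : ℝ) + 1) ^ r := by positivity
    have e2 : (k : ℝ) / (k : ℝ) ^ r = (k * ((k : ℝ) + 1) ^ r) / (k : ℝ) ^ r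
        * (((k : ℝ) + 1) ^ r)⁻¹ := by
      field_simp
    rw [e2, div_eq_mul_inv ((k : ℝ) + 1), ← sub_mul, mul_comm]
    refine mul_le_mul_of_nonneg_right ?_ (by positivity)
    rw [le_sub_iff_add_le, le_div_iff₀ hA]
    have e3 : (1 + r * (1 / (k : ℝ))) * (k : ℝ) ^ r * k = (r - 1 + (k + 1)) * (k : ℝ) ^ r := by
      field_simp
      ring
    rw [← e3, mul_comm (k : ℝ)]
    gcongr
  refine (Finset.sum_le_sum key).trans ?_
  rw [← Finset.mul_sum]
  gcongr
  rcases le_total (m + 1) N with h | h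
  · have := Finset.sum_Ico_sub (fun k : ℕ => -(k : ℝ) ^ (1 - r)) h
    simp only [neg_sub_neg] at this
    rw [this]
    push_cast
    linarith [(by positivity : 0 ≤ (N : ℝ) ^ (1 - r))]
  · rw [Finset.Ico_eq_empty_of_le h, Finset.sum_empty]
    positivity

/-- A positive sequence `w k`, thought of as `b (k + 1)`, for which `n ^ β * b n` is increasing
and `n ^ γ * b n` is decreasing. -/
structure PowerBounded (w : ℕ → ℝ) (β γ : ℝ) : Prop where
  pos : ∀ k, 0 < w k
  le_mul_rpow : ∀ i j : ℕ, i ≤ j → w i ≤ w j * (((j : ℝ) + 1) / ((i : ℝ) + 1)) ^ β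
  mul_rpow_le : ∀ i j : ℕ, i ≤ j → w j * (((j : ℝ) + 1) / ((i : ℝ) + 1)) ^ γ ≤ w i

namespace PowerBounded

variable {w : ℕ → ℝ} {β γ : ℝ}

lemma of_monotoneOn_antitoneOn {ρ : ℝ → ℝ} (hρ_pos : ∀ x ∈ Ici (1 : ℝ), 0 < ρ x)
    (hρ_inc : MonotoneOn (fun t => ρ t / t ^ γ) (Ici 1))
    (hρ_dec : AntitoneOn (fun t => ρ t / t ^ β) (Ici 1)) :
    PowerBounded (fun k : ℕ => 1 / ρ (k + 1)) β γ := by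
  have mem : ∀ k : ℕ, (k : ℝ) + 1 ∈ Ici (1 : ℝ) := fun k => by simp
  refine ⟨fun k => one_div_pos.2 (hρ_pos _ (mem k)), fun i j hij => ?_, fun i j hij => ?_⟩
  all_goals
    have hi := hρ_pos _ (mem i)
    have hj := hρ_pos _ (mem j)
    have hij' : (i : ℝ) + 1 ≤ j + 1 := by exact_mod_cast Nat.succ_le_succ hij
    rw [Real.div_rpow (by positivity) (by positivity), div_mul_div_comm, one_mul,
      div_le_div_iff₀ (by positivity) (by positivity)]
  · have := hρ_dec (mem i) (mem j) hij'
    rw [div_le_div_iff₀ (by positivity) (by positivity)] at this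
    linarith
  · have := hρ_inc (mem i) (mem j) hij'
    rw [div_le_div_iff₀ (by positivity) (by positivity)] at this
    linarith

lemma sum_range_rpow_le (hw : PowerBounded w β γ) {p : ℝ} (hp : 0 < p) (hβ : 0 < β)
    (hpβ : β * p < 1) (m : ℕ) :
    ∑ k ∈ Finset.range (m + 1), w k ^ p ≤ (1 / (1 - β * p)) * ((m + 1) * w m ^ p) := by
  have hm : (0 : ℝ) < (m : ℝ) + 1 := by positivity
  have hwm := hw.pos m
  have key : ∀ k ∈ Finset.range (m + 1), w k ^ p
      ≤ (w m ^ p * ((m : ℝ) + 1) ^ (β * p)) * ((k : ℝ) + 1) ^ (-(β * p)) := by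
    intro k hk
    have hk0 : (0 : ℝ) < (k : ℝ) + 1 := by positivity
    refine (Real.rpow_le_rpow (hw.pos k).le
      (hw.le_mul_rpow k m (Nat.lt_succ_iff.1 (Finset.mem_range.1 hk))) hp.le).trans_eq ?_
    rw [Real.mul_rpow hwm.le (by positivity), ← Real.rpow_mul (by positivity),
      Real.div_rpow hm.le hk0.le, Real.rpow_neg hk0.le]
    ring
  refine (Finset.sum_le_sum key).trans ?_
  rw [← Finset.mul_sum]
  refine (mul_le_mul_of_nonneg_left (sum_range_rpow_neg_le (by positivity) hpβ (m + 1))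
    (by positivity)).trans_eq ?_
  push_cast
  rw [Real.rpow_sub hm, Real.rpow_one]
  field_simp

lemma sum_Ico_le (hw : PowerBounded w β γ) (hγ : 1 < γ) (m N : ℕ) :
    ∑ k ∈ Finset.Ico (m + 1) N, w k ≤ (1 / (γ - 1)) * ((m + 1) * w m) := by
  have hm : (0 : ℝ) < (m : ℝ) + 1 := by positivity
  have hwm := hw.pos m
  have key : ∀ k ∈ Finset.Ico (m + 1) N, w k
      ≤ (w m * ((m : ℝ) + 1) ^ γ) * ((k : ℝ) + 1) ^ (-γ) := by
    intro k hk
    have hk0 : (0 : ℝ) < (k : ℝ) + 1 := by positivity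
    have h := hw.mul_rpow_le m k (by have := (Finset.mem_Ico.1 hk).1; omega)
    rw [Real.div_rpow hk0.le hm.le, mul_div_assoc', div_le_iff₀ (by positivity)] at h
    rwa [Real.rpow_neg hk0.le, ← div_eq_mul_inv, le_div_iff₀ (by positivity)]
  refine (Finset.sum_le_sum key).trans ?_
  rw [← Finset.mul_sum]
  refine (mul_le_mul_of_nonneg_left (sum_Ico_rpow_neg_le hγ m N) (by positivity)).trans_eq ?_
  rw [Real.rpow_sub hm, Real.rpow_one]
  field_simp

end PowerBounded

/-- Minorant of the sum of the test function with crossover value `s`. -/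
lemma succ_mul_le_sum_crossover {p s : ℝ} (hp : 0 < p) (hs : 0 < s) {v : ℕ → ℝ} {m : ℕ}
    (hv : ∀ k ≤ m, s ≤ v k) :
    ((m : ℝ) + 1) * s ≤ ∑ k ∈ Finset.range (m + 1), crossover p s (v k) := by
  have := Finset.card_nsmul_le_sum (Finset.range (m + 1)) (fun k => crossover p s (v k)) s
    fun k hk => crossover.le_of_le hp hs (hv k (Nat.lt_succ_iff.1 (Finset.mem_range.1 hk)))
  simpa using this

lemma exists_pos_forall_le_mul {a w : ℕ → ℝ} {β γ p B : ℝ} (ha_pos : ∀ n, 0 < a n)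
    (ha_anti : Antitone a) (hw : PowerBounded w β γ) (hβ : 0 < β) (hγ : 1 < γ) (hp : 0 < p)
    (hp1 : p < 1) (hpβ : β * p < 1) (hB : 0 < B)
    (h : ∀ s > 0, ∑' n, ENNReal.ofReal (crossover p s (a n))
      ≤ ENNReal.ofReal B * ∑' n, ENNReal.ofReal (crossover p s (w n))) :
    ∃ C > 0, ∀ n, a n ≤ C * w n := by
  have hq : 0 < 1 - β * p := by linarith
  have hγ' : 0 < γ - 1 := by linarith
  set C₁ := 1 / (1 - β * p) with hC₁
  set C₂ := 1 / (γ - 1) with hC₂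
  have hC₁0 : 0 < C₁ := by positivity
  have hC₂0 : 0 < C₂ := by positivity
  set D := B * (C₁ + C₂) with hD
  have hD0 : 0 < D := by positivity
  refine ⟨max 1 (D ^ (1 / p)), by positivity, fun m => ?_⟩
  have hs := ha_pos m
  have hwm := hw.pos m
  have hm : (0 : ℝ) < (m : ℝ) + 1 := by positivity
  rcases le_total (a m) (w m) with hle | hle
  · exact hle.trans (le_mul_of_one_le_left hwm.le (le_max_left _ _))
  have upper : ∀ N, ∑ k ∈ Finset.range N, crossover p (a m) (w k)
      ≤ a m ^ (1 - p) * (C₁ * ((m + 1) * w m ^ p)) + C₂ * ((m + 1) * w m) := by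
    intro N
    refine (sum_range_le_add_sum_Ico
      (fun k => crossover.nonneg hs (hw.pos k).le) (m + 1) N).trans (add_le_add ?_ ?_)
    · refine (Finset.sum_le_sum fun k _ => min_le_right _ _).trans ?_
      rw [← Finset.mul_sum]
      gcongr
      exact hw.sum_range_rpow_le hp hβ hpβ m
    · exact (Finset.sum_le_sum fun k _ => min_le_left _ _).trans (hw.sum_Ico_le hγ m N)
  have main := (succ_mul_le_sum_crossover hp hs fun k hk => ha_anti hk).trans
    (sum_range_le_mul_of_tsum_ofReal_le (fun k => crossover.nonneg hs (ha_pos k).le)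
      (fun k => crossover.nonneg hs (hw.pos k).le) hB upper (h _ hs) (m + 1))
  have hw_le : w m ≤ a m ^ (1 - p) * w m ^ p := by
    calc w m = w m ^ (1 - p) * w m ^ p := by rw [← Real.rpow_add hwm]; simp
      _ ≤ a m ^ (1 - p) * w m ^ p := by gcongr
  have main' : a m ≤ D * (a m ^ (1 - p) * w m ^ p) := by
    refine le_of_mul_le_mul_left (main.trans ?_) hm
    have : C₂ * w m ≤ C₂ * (a m ^ (1 - p) * w m ^ p) := by gcongr
    have : B * (m + 1) * (C₂ * w m) ≤ B * (m + 1) * (C₂ * (a m ^ (1 - p) * w m ^ p)) := by gcongr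
    rw [hD]
    linarith
  have hpow : a m ^ p ≤ D * w m ^ p := by
    have e : a m ^ p * a m ^ (1 - p) = a m := by rw [← Real.rpow_add hs]; simp
    refine le_of_mul_le_mul_right ?_ (by positivity : 0 < a m ^ (1 - p))
    rw [e]
    linarith
  have := Real.rpow_le_rpow (by positivity) hpow (by positivity : 0 ≤ 1 / p)
  rw [Real.mul_rpow hD0.le (by positivity), ← Real.rpow_mul hs.le, ← Real.rpow_mul hwm.le,
    mul_one_div_cancel hp.ne', Real.rpow_one, Real.rpow_one] at this
  exact this.trans (by gcongr; exact le_max_right _ _)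

lemma eventually_mul_natCast_rpow_neg_le (A : ℝ) {r ε : ℝ} (hr : 0 < r) (hε : 0 < ε) :
    ∀ᶠ K : ℕ in atTop, A * (K : ℝ) ^ (-r) ≤ ε := by
  have : Tendsto (fun K : ℕ => A * (K : ℝ) ^ (-r)) atTop (𝓝 (A * 0)) :=
    ((tendsto_rpow_neg_atTop hr).comp tendsto_natCast_atTop_atTop).const_mul A
  rw [mul_zero] at this
  exact (this.eventually (gt_mem_nhds hε)).mono fun _ h => h.le

lemma exists_pos_forall_mul_le {a w : ℕ → ℝ} {β γ p B C : ℝ} (ha_pos : ∀ n, 0 < a n)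
    (ha_anti : Antitone a) (hw : PowerBounded w β γ) (hβ : 0 < β) (hγ : 1 < γ) (hp : 0 < p)
    (hpβ : β * p < 1) (hB : 0 < B) (hC : 0 < C) (haw : ∀ n, a n ≤ C * w n)
    (h : ∀ s > 0, ∑' n, ENNReal.ofReal (crossover p s (w n))
      ≤ ENNReal.ofReal B * ∑' n, ENNReal.ofReal (crossover p s (a n))) :
    ∃ c > 0, ∀ n, c * w n ≤ a n := by
  have hq : 0 < 1 - β * p := by linarith
  have hγ' : 0 < γ - 1 := by linarith
  set C₁ := 1 / (1 - β * p) with hC₁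
  set C₂ := 1 / (γ - 1) with hC₂
  have hC₁0 : 0 < C₁ := by positivity
  have hC₂0 : 0 < C₂ := by positivity
  obtain ⟨K, ⟨hK₁, hK₂⟩, hK⟩ :=
    (((eventually_mul_natCast_rpow_neg_le (B * (C ^ p * C₁)) hq (by norm_num : (0 : ℝ) < 1 / 4)).and
      (eventually_mul_natCast_rpow_neg_le (B * (C * C₂)) hγ' (by norm_num : (0 : ℝ) < 1 / 4))).and
      (eventually_ge_atTop 1)).exists
  have hK0 : (0 : ℝ) < K := by exact_mod_cast hK
  refine ⟨1 / (2 * B * K * (K : ℝ) ^ β), by positivity, fun m => ?_⟩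
  obtain ⟨M, hM⟩ : ∃ M, M + 1 = K * (m + 1) :=
    ⟨K * (m + 1) - 1, Nat.sub_add_cancel (Nat.mul_pos hK m.succ_pos)⟩
  obtain ⟨L, hL⟩ : ∃ L, L + 1 = K * (M + 1) :=
    ⟨K * (M + 1) - 1, Nat.sub_add_cancel (Nat.mul_pos hK M.succ_pos)⟩
  have hmM : m ≤ M := by nlinarith
  have hML : M ≤ L := by nlinarith
  have hMr : (M : ℝ) + 1 = K * (m + 1) := by exact_mod_cast hM
  have hLr : (L : ℝ) + 1 = K * (M + 1) := by exact_mod_cast hL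
  have hm0 : (0 : ℝ) < (m : ℝ) + 1 := by positivity
  have hM0 : (0 : ℝ) < (M : ℝ) + 1 := by positivity
  have hs := hw.pos M
  have hwm := hw.pos m
  have hwL := hw.pos L
  have ham := ha_pos m
  have hwmM : w m ≤ w M * (K : ℝ) ^ β := by
    have := hw.le_mul_rpow m M hmM
    rwa [hMr, mul_div_cancel_right₀ _ hm0.ne'] at this
  have hwML : w L * (K : ℝ) ^ γ ≤ w M := by
    have := hw.mul_rpow_le M L hML
    rwa [hLr, mul_div_cancel_right₀ _ hM0.ne'] at this
  have upper : ∀ N, ∑ k ∈ Finset.range N, crossover p (w M) (a k)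
      ≤ w M ^ (1 - p) * (C ^ p * (C₁ * ((m + 1) * w m ^ p)))
        + ((L + 1) * a m + C * (C₂ * ((L + 1) * w L))) := by
    intro N
    have hnn : ∀ k, 0 ≤ crossover p (w M) (a k) := fun k => crossover.nonneg hs (ha_pos k).le
    have hmid : ∑ k ∈ Finset.Ico (m + 1) (L + 1), crossover p (w M) (a k) ≤ (L + 1) * a m := by
      calc ∑ k ∈ Finset.Ico (m + 1) (L + 1), crossover p (w M) (a k)
          ≤ ∑ k ∈ Finset.Ico (m + 1) (L + 1), a m := Finset.sum_le_sum fun k hk =>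
            (min_le_left _ _).trans (ha_anti (by have := (Finset.mem_Ico.1 hk).1; omega))
        _ ≤ ∑ k ∈ Finset.range (L + 1), a m :=
            Finset.sum_le_sum_of_subset_of_nonneg
              (fun k hk => Finset.mem_range.2 (Finset.mem_Ico.1 hk).2) fun _ _ _ => ham.le
        _ = (L + 1) * a m := by simp
    have hhead : ∑ k ∈ Finset.range (m + 1), crossover p (w M) (a k)
        ≤ w M ^ (1 - p) * (C ^ p * (C₁ * ((m + 1) * w m ^ p))) := by
      calc ∑ k ∈ Finset.range (m + 1), crossover p (w M) (a k)
          ≤ ∑ k ∈ Finset.range (m + 1), w M ^ (1 - p) * (C ^ p * w k ^ p) := by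
            refine Finset.sum_le_sum fun k _ => (min_le_right _ _).trans ?_
            rw [← Real.mul_rpow hC.le (hw.pos k).le]
            have := (ha_pos k).le
            gcongr
            exact haw k
        _ ≤ _ := by
            rw [← Finset.mul_sum, ← Finset.mul_sum]
            gcongr
            exact hw.sum_range_rpow_le hp hβ hpβ m
    have htail : ∑ k ∈ Finset.Ico (L + 1) N, crossover p (w M) (a k)
        ≤ C * (C₂ * ((L + 1) * w L)) := by
      refine (Finset.sum_le_sum fun k _ => (min_le_left _ _).trans (haw k)).trans ?_
      rw [← Finset.mul_sum]
      gcongr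
      exact hw.sum_Ico_le hγ L N
    have h₁ := sum_range_le_add_sum_Ico hnn (L + 1) N
    have h₂ := sum_range_le_add_sum_Ico hnn (m + 1) (L + 1)
    linarith
  have main := (succ_mul_le_sum_crossover hp hs fun k hk => by
      have hk' : (k : ℝ) + 1 ≤ M + 1 := by exact_mod_cast Nat.succ_le_succ hk
      refine le_trans ?_ (hw.mul_rpow_le k M hk)
      refine le_mul_of_one_le_right hs.le (Real.one_le_rpow ?_ (by linarith))
      rwa [one_le_div (by positivity)]).trans
    (sum_range_le_mul_of_tsum_ofReal_le (fun k => crossover.nonneg hs (hw.pos k).le)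
      (fun k => crossover.nonneg hs (ha_pos k).le) hB upper (h _ hs) (M + 1))
  have hhead : w M ^ (1 - p) * ((m + 1) * w m ^ p)
      ≤ (M + 1) * w M * (K : ℝ) ^ (-(1 - β * p)) := by
    calc w M ^ (1 - p) * ((m + 1) * w m ^ p)
        ≤ w M ^ (1 - p) * ((m + 1) * (w M * (K : ℝ) ^ β) ^ p) := by gcongr
      _ = (m + 1) * (w M ^ (1 - p) * w M ^ p) * (K : ℝ) ^ (β * p) := by
          rw [Real.mul_rpow hs.le (by positivity), ← Real.rpow_mul hK0.le]
          ring
      _ = (M + 1) * w M * (K : ℝ) ^ (-(1 - β * p)) := by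
          rw [← Real.rpow_add hs, sub_add_cancel, Real.rpow_one, neg_sub, Real.rpow_sub hK0,
            Real.rpow_one, hMr]
          field_simp
  have htail : (L + 1) * w L ≤ (M + 1) * w M * (K : ℝ) ^ (-(γ - 1)) := by
    rw [hLr, neg_sub, Real.rpow_sub hK0, Real.rpow_one, mul_div_assoc',
      le_div_iff₀ (by positivity)]
    calc K * ((M : ℝ) + 1) * w L * (K : ℝ) ^ γ = K * (M + 1) * (w L * (K : ℝ) ^ γ) := by ring
      _ ≤ K * (M + 1) * w M := by gcongr
      _ = (M + 1) * w M * K := by ring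
  have hX : 0 < ((M : ℝ) + 1) * w M := by positivity
  have t₁ : B * (C ^ p * C₁) * (w M ^ (1 - p) * ((m + 1) * w m ^ p))
      ≤ 1 / 4 * ((M + 1) * w M) := by
    calc _ ≤ B * (C ^ p * C₁) * ((M + 1) * w M * (K : ℝ) ^ (-(1 - β * p))) := by gcongr
      _ = B * (C ^ p * C₁) * (K : ℝ) ^ (-(1 - β * p)) * ((M + 1) * w M) := by ring
      _ ≤ _ := by gcongr
  have t₂ : B * (C * C₂) * ((L + 1) * w L) ≤ 1 / 4 * ((M + 1) * w M) := by
    calc _ ≤ B * (C * C₂) * ((M + 1) * w M * (K : ℝ) ^ (-(γ - 1))) := by gcongr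
      _ = B * (C * C₂) * (K : ℝ) ^ (-(γ - 1)) * ((M + 1) * w M) := by ring
      _ ≤ _ := by gcongr
  rw [hLr] at main t₂
  have hfin : w M ≤ 2 * B * K * a m := by
    refine le_of_mul_le_mul_left ?_ hM0
    linarith
  rw [div_mul_eq_mul_div, one_mul, div_le_iff₀ (by positivity)]
  calc w m ≤ w M * (K : ℝ) ^ β := hwmM
    _ ≤ 2 * B * K * a m * (K : ℝ) ^ β := by gcongr
    _ = a m * (2 * B * K * (K : ℝ) ^ β) := by ring

/-- **Lemma 3.2.** Let `(a_n)` be a positive decreasing sequence (0-indexed,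
`a n = a_{n+1}`) and `ρ : [1,∞) → (0,∞)` increasing, with `ρ(t)/t^γ` increasing and
`ρ(t)/t^β` decreasing for some `β, γ > 1`.  Let `p ∈ (0, 1/β)` and suppose there is
`B > 0` such that for every increasing concave `h : [0,∞) → [0,∞)` with `h(t)/t^p`
increasing, `(1/B) ∑_n h(1/ρ(n)) ≤ ∑_n h(a_n) ≤ B ∑_n h(1/ρ(n))` (sums in `[0,∞]`).
Then `a_n ≍ 1/ρ(n)`. -/
theorem lemma_3_2
    (a : ℕ → ℝ) (ha_pos : ∀ n, 0 < a n) (ha_anti : Antitone a)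
    (ρ : ℝ → ℝ) (hρ_mono : MonotoneOn ρ (Ici 1)) (hρ_pos : ∀ x ∈ Ici (1 : ℝ), 0 < ρ x)
    (β γ : ℝ) (hβ : 1 < β) (hγ : 1 < γ)
    (hρ_inc : MonotoneOn (fun t => ρ t / t ^ γ) (Ici 1))
    (hρ_dec : AntitoneOn (fun t => ρ t / t ^ β) (Ici 1))
    (p : ℝ) (hp0 : 0 < p) (hpβ : p < 1 / β)
    (hB : ∃ B > 0, ∀ h : ℝ → ℝ,
      MonotoneOn h (Ici 0) → ConcaveOn ℝ (Ici 0) h → (∀ t ∈ Ici (0 : ℝ), 0 ≤ h t) →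
      MonotoneOn (fun t => h t / t ^ p) (Ioi 0) →
      (∑' n : ℕ, ENNReal.ofReal (h (1 / ρ (n + 1)))
          ≤ ENNReal.ofReal B * ∑' n : ℕ, ENNReal.ofReal (h (a n))) ∧
      (∑' n : ℕ, ENNReal.ofReal (h (a n))
          ≤ ENNReal.ofReal B * ∑' n : ℕ, ENNReal.ofReal (h (1 / ρ (n + 1))))) :
    ∃ c > 0, ∃ C > 0, ∀ n : ℕ, c / ρ (n + 1) ≤ a n ∧ a n ≤ C / ρ (n + 1) := by
  obtain ⟨B, hB0, hB⟩ := hB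
  have hβ0 : 0 < β := by linarith
  have hpβ' : β * p < 1 := by rwa [lt_div_iff₀ hβ0, mul_comm] at hpβ
  have hp1 : p < 1 := by nlinarith
  have hw := PowerBounded.of_monotoneOn_antitoneOn hρ_pos hρ_inc hρ_dec
  have test : ∀ s : ℝ, 0 < s → _ := fun s hs => hB (crossover p s) (crossover.monotoneOn hp0 hs)
    (crossover.concaveOn hp0 hp1 hs) (fun t ht => crossover.nonneg hs ht)
    (crossover.monotoneOn_div_rpow hp1)
  obtain ⟨C, hC, haC⟩ := exists_pos_forall_le_mul ha_pos ha_anti hw hβ0 hγ hp0 hp1 hpβ' hB0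
    fun s hs => (test s hs).2
  obtain ⟨c, hc, hca⟩ := exists_pos_forall_mul_le ha_pos ha_anti hw hβ0 hγ hp0 hpβ' hB0 hC haC
    fun s hs => (test s hs).1
  refine ⟨c, hc, C, hC, fun n => ⟨?_, ?_⟩⟩
  · simpa only [mul_one_div] using hca n
  · simpa only [mul_one_div] using haC n
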